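/- Let A be a d₁×d₁ Hermitian complex matrix, B a d₂×d₂ Hermitian complex matrix, Φ a Hermiticity-preserving linear map from d₁×d₁ to d₂×d₂ complex matrices, and c > 0. Let X, Z be d₁×d₁ positive semidefinite matrices and W, Y be d₂×d₂ positive semidefinite matrices with ‖X‖₂ ≤ c and ‖Y‖₂ ≤ c. Then Re Tr[A·X] − c·‖B − Φ(X) − W‖₂ ≤ Re Tr[B·Y] + c·‖Φ†(Y) − A − Z‖₂. Consequently, α′_{2,2}(c) := sup over such (X, W) of the left-hand side is at most β′_{2,2}(c) := inf over such (Y, Z) of the right-hand side. -/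

import Mathlib

open Matrix Filter
open scoped ComplexOrder

noncomputable section

/-- The Hilbert–Schmidt (Frobenius) norm of a complex matrix. -/
def hsNorm {ι : Type*} [Fintype ι] (M : Matrix ι ι ℂ) : ℝ :=
  Real.sqrt ((Mᴴ * M).trace.re)

theorem hsNorm_nonneg {ι : Type*} [Fintype ι] (M : Matrix ι ι ℂ) : 0 ≤ hsNorm M :=
  Real.sqrt_nonneg _

/-- Cauchy–Schwarz for the Hilbert–Schmidt inner product, in the form of a lower bound. -/
theorem neg_hsNorm_mul_le_re_trace {ι : Type*} [Fintype ι] (M N : Matrix ι ι ℂ) :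
    -(hsNorm M * hsNorm N) ≤ ((Mᴴ * N).trace).re := by
  let v : Matrix ι ι ℂ → EuclideanSpace ℂ (ι × ι) := fun M => WithLp.toLp 2 fun p => M p.1 p.2
  have inner_eq (M N : Matrix ι ι ℂ) : inner ℂ (v M) (v N) = (Mᴴ * N).trace := by
    simp only [v, PiLp.inner_apply, Fintype.sum_prod_type, trace, diag_apply, mul_apply,
      conjTranspose_apply, RCLike.inner_apply]
    rw [Finset.sum_comm]
    simp [mul_comm]
  have norm_eq (M : Matrix ι ι ℂ) : ‖v M‖ = hsNorm M := by
    rw [hsNorm, ← inner_eq, @norm_eq_sqrt_re_inner ℂ]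
    rfl
  rw [← inner_eq, ← norm_eq, ← norm_eq]
  exact neg_le_of_abs_le ((Complex.abs_re_le_norm _).trans (norm_inner_le_norm _ _))

open scoped MatrixOrder Matrix.Norms.L2Operator in
theorem Matrix.PosSemidef.re_trace_mul_nonneg {ι : Type*} [Fintype ι] {P Q : Matrix ι ι ℂ}
    (hP : P.PosSemidef) (hQ : Q.PosSemidef) : 0 ≤ ((P * Q).trace).re := by
  classical
  obtain ⟨R, rfl⟩ := CStarAlgebra.nonneg_iff_eq_star_mul_self.mp hQ.nonneg
  rw [← Matrix.mul_assoc, trace_mul_comm, ← Matrix.mul_assoc]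
  exact (Complex.le_def.mp (hP.mul_mul_conjTranspose_same R).trace_nonneg).1

theorem weak_duality_penalty (d₁ d₂ : ℕ)
    (A : Matrix (Fin d₁) (Fin d₁) ℂ) (hA : A.IsHermitian)
    (B : Matrix (Fin d₂) (Fin d₂) ℂ) (hB : B.IsHermitian)
    (Φ : Matrix (Fin d₁) (Fin d₁) ℂ →ₗ[ℂ] Matrix (Fin d₂) (Fin d₂) ℂ)
    (hΦ : ∀ X, X.IsHermitian → (Φ X).IsHermitian)
    (Φd : Matrix (Fin d₂) (Fin d₂) ℂ →ₗ[ℂ] Matrix (Fin d₁) (Fin d₁) ℂ)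
    (hΦd : ∀ (X : Matrix (Fin d₁) (Fin d₁) ℂ) (Y : Matrix (Fin d₂) (Fin d₂) ℂ),
      (Yᴴ * Φ X).trace = ((Φd Y)ᴴ * X).trace)
    (c : ℝ) (hc : 0 < c)
    (X Z : Matrix (Fin d₁) (Fin d₁) ℂ) (hX : X.PosSemidef) (hZ : Z.PosSemidef)
    (W Y : Matrix (Fin d₂) (Fin d₂) ℂ) (hW : W.PosSemidef) (hY : Y.PosSemidef)
    (hXc : hsNorm X ≤ c) (hYc : hsNorm Y ≤ c) :
    (((A * X).trace).re - c * hsNorm (B - Φ X - W)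
        ≤ ((B * Y).trace).re + c * hsNorm (Φd Y - A - Z)) ∧
    sSup {v : ℝ | ∃ (X' : Matrix (Fin d₁) (Fin d₁) ℂ)
          (W' : Matrix (Fin d₂) (Fin d₂) ℂ),
        X'.PosSemidef ∧ W'.PosSemidef ∧ hsNorm X' ≤ c ∧
        v = ((A * X').trace).re - c * hsNorm (B - Φ X' - W')}
      ≤ sInf {v : ℝ | ∃ (Y' : Matrix (Fin d₂) (Fin d₂) ℂ)
          (Z' : Matrix (Fin d₁) (Fin d₁) ℂ),
        Y'.PosSemidef ∧ Z'.PosSemidef ∧ hsNorm Y' ≤ c ∧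
        v = ((B * Y').trace).re + c * hsNorm (Φd Y' - A - Z')} := by
  have weak (X Z : Matrix (Fin d₁) (Fin d₁) ℂ) (W Y : Matrix (Fin d₂) (Fin d₂) ℂ)
      (hX : X.PosSemidef) (hZ : Z.PosSemidef) (hW : W.PosSemidef) (hY : Y.PosSemidef)
      (hXc : hsNorm X ≤ c) (hYc : hsNorm Y ≤ c) :
      ((A * X).trace).re - c * hsNorm (B - Φ X - W)
        ≤ ((B * Y).trace).re + c * hsNorm (Φd Y - A - Z) := by
    have hD := neg_hsNorm_mul_le_re_trace Y (B - Φ X - W)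
    have hE := neg_hsNorm_mul_le_re_trace (Φd Y - A - Z) X
    have hD' := mul_le_mul_of_nonneg_right hYc (hsNorm_nonneg (B - Φ X - W))
    have hE' := mul_le_mul_of_nonneg_left hXc (hsNorm_nonneg (Φd Y - A - Z))
    have hYW := hY.re_trace_mul_nonneg hW
    have hZX := hZ.re_trace_mul_nonneg hX
    simp only [Matrix.mul_sub, trace_sub, Complex.sub_re, hΦd] at hD
    simp only [conjTranspose_sub, Matrix.sub_mul, trace_sub, Complex.sub_re, hA.eq,
      hZ.isHermitian.eq] at hE
    rw [hY.isHermitian.eq, trace_mul_comm Y B] at hD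
    linarith
  refine ⟨weak X Z W Y hX hZ hW hY hXc hYc, ?_⟩
  refine csSup_le ⟨_, X, W, hX, hW, hXc, rfl⟩ ?_
  rintro _ ⟨X', W', hX', hW', hXc', rfl⟩
  refine le_csInf ⟨_, Y, Z, hY, hZ, hYc, rfl⟩ ?_
  rintro _ ⟨Y', Z', hY', hZ', hYc', rfl⟩
  exact weak X' Z' W' Y' hX' hZ' hW' hY' hXc' hYc'
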